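/- Every unit of the ring of integers 𝓞_𝕜 of 𝕜 = ℚ(√(2p₁p₂), i) is of the form i^j · ε_{2p₁p₂}^k with j, k ∈ ℤ; that is, the unit group of 𝓞_𝕜 is generated by i and the fundamental unit ε_{2p₁p₂} of ℚ(√(2p₁p₂)). -/

import Mathlib

open NumberField IntermediateField

/-- `ε` is the fundamental unit of the real quadratic field `ℚ(√D)` (for `D > 1` squarefree):
elements of the ring of integers of `ℚ(√D)` are exactly the numbers `(x + y√D)/2` with
`x ≡ y·D (mod 2)`, and units are those with `x² - Dy² = ±4`.  The fundamental unit is the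
least unit `> 1`; equivalently, every unit is of the form `±ε^k` with `k ∈ ℤ`. -/
def IsFundUnit (D : ℕ) (ε : ℝ) : Prop :=
  1 < ε ∧
  (∃ x y : ℤ, ε = ((x : ℝ) + (y : ℝ) * Real.sqrt D) / 2 ∧
    (x ^ 2 - (D : ℤ) * y ^ 2 = 4 ∨ x ^ 2 - (D : ℤ) * y ^ 2 = -4)) ∧
  ∀ x y : ℤ, (x ^ 2 - (D : ℤ) * y ^ 2 = 4 ∨ x ^ 2 - (D : ℤ) * y ^ 2 = -4) →
    1 < ((x : ℝ) + (y : ℝ) * Real.sqrt D) / 2 →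
    ε ≤ ((x : ℝ) + (y : ℝ) * Real.sqrt D) / 2

theorem exists_two_mul_of_sq_sub_mul_sq {D : ℕ} (hD : D % 4 = 2) {m c : ℤ}
    (h : 4 ∣ m ^ 2 - (D : ℤ) * c ^ 2) : ∃ x y : ℤ, m = 2 * x ∧ c = 2 * y := by
  obtain ⟨q, hq⟩ : ∃ q : ℤ, (D : ℤ) = 4 * q + 2 := ⟨D / 4, by omega⟩
  rw [hq] at h
  rcases Int.even_or_odd' m with ⟨x, rfl | rfl⟩ <;> rcases Int.even_or_odd' c with ⟨y, rfl | rfl⟩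
  · exact ⟨x, y, rfl, rfl⟩
  all_goals
    exfalso
    ring_nf at h
    omega

/-- If `D ≡ 2 (mod 4)` is squarefree and `a + b√D` has integral trace `2a` and norm `a² - Db²`,
then `a` and `b` are integers. -/
theorem exists_int_coords_of_int_trace_norm {D : ℕ} (hD : D % 4 = 2) (hsq : Squarefree D)
    {a b : ℚ} {m n : ℤ} (hm : 2 * a = m) (hn : a ^ 2 - D * b ^ 2 = n) :
    ∃ x y : ℤ, a = x ∧ b = y := by
  have hD0 : (D : ℚ) ≠ 0 := by
    have : D ≠ 0 := by omega
    exact_mod_cast this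
  have hsq' : Squarefree (D : ℤ) := Int.squarefree_natCast.2 hsq
  have hint : IsIntegral ℤ ((D : ℚ) * (2 * b)) := by
    refine IsIntegral.of_pow (n := 2) two_pos ?_
    have : ((D : ℚ) * (2 * b)) ^ 2 = ((D * (m ^ 2 - 4 * n) : ℤ) : ℚ) := by
      push_cast
      rw [← hm, ← hn]
      ring
    rw [this]
    exact isIntegral_algebraMap (R := ℤ) (A := ℚ)
  obtain ⟨k, hk⟩ := IsIntegrallyClosed.isIntegral_iff.1 hint
  have hk' : (k : ℚ) = D * (2 * b) := hk
  have hk2 : k ^ 2 = D * (m ^ 2 - 4 * n) := by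
    have : (k : ℚ) ^ 2 = D * ((m : ℚ) ^ 2 - 4 * n) := by
      rw [hk', ← hm, ← hn]
      ring
    exact_mod_cast this
  obtain ⟨c, rfl⟩ := (hsq'.dvd_pow_iff_dvd two_ne_zero).1 (Dvd.intro _ hk2.symm)
  have hc : (c : ℚ) = 2 * b := by
    push_cast at hk'
    exact mul_left_cancel₀ hD0 hk'
  have hmn : m ^ 2 - D * c ^ 2 = 4 * n := by
    have : (m : ℚ) ^ 2 - D * (c : ℚ) ^ 2 = 4 * n := by
      rw [hc, ← hm, ← hn]
      ring
    exact_mod_cast this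
  obtain ⟨x, y, rfl, rfl⟩ := exists_two_mul_of_sq_sub_mul_sq hD (Dvd.intro _ hmn.symm)
  push_cast at hm hc
  exact ⟨x, y, by linarith, by linarith⟩

theorem irrational_sqrt_of_mod_four_eq_two {D : ℕ} (hD : D % 4 = 2) :
    Irrational (Real.sqrt D) := by
  rw [irrational_sqrt_natCast_iff]
  rintro ⟨r, rfl⟩
  have := Nat.mod_lt r (show 4 > 0 by norm_num)
  rw [Nat.mul_mod] at hD
  interval_cases r % 4 <;> simp at hD

theorem eq_zero_of_add_mul_irrational {s : ℝ} (hs : Irrational s) {a b : ℚ}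
    (h : (a : ℝ) + b * s = 0) : a = 0 ∧ b = 0 := by
  have hb : b = 0 := by
    by_contra hb
    exact ((hs.ratCast_mul hb).ratCast_add a).ne_zero h
  subst hb
  simpa using h

/-- Integral elements of `ℚ(√D)`, for `D ≡ 2 (mod 4)` squarefree, lie in `ℤ[√D]`. -/
theorem exists_int_coords_of_isIntegral {D : ℕ} (hD : D % 4 = 2) (hsq : Squarefree D)
    {a b : ℚ} (h : IsIntegral ℤ ((a : ℝ) + b * Real.sqrt D)) :
    ∃ x y : ℤ, a = x ∧ b = y := by
  have hs := irrational_sqrt_of_mod_four_eq_two hD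
  have hss : Real.sqrt D ^ 2 = D := Real.sq_sqrt (Nat.cast_nonneg D)
  by_cases hb : b = 0
  · subst hb
    have ha : IsIntegral ℤ (algebraMap ℚ ℝ a) := by simpa using h
    rw [isIntegral_algebraMap_iff (algebraMap ℚ ℝ).injective] at ha
    obtain ⟨x, hx⟩ := IsIntegrallyClosed.isIntegral_iff.1 ha
    exact ⟨x, 0, by simpa using hx.symm, by simp⟩
  · set α : ℝ := a + b * Real.sqrt D with hα
    have hαirr : Irrational α := (hs.ratCast_mul hb).ratCast_add a
    have hαint : IsIntegral ℚ α := h.tower_top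
    let q : Polynomial ℚ := .X ^ 2 - .C (2 * a) * .X + .C (a ^ 2 - D * b ^ 2)
    have hqdeg : q.natDegree = 2 := by
      simp only [q]
      compute_degree!
    have hqm : q.Monic := by
      simp only [q]
      monicity!
    have hroot : Polynomial.aeval α q = 0 := by
      simp only [q, map_add, map_sub, map_mul, map_pow, Polynomial.aeval_X, Polynomial.aeval_C,
        eq_ratCast, hα]
      push_cast
      linear_combination (b : ℝ) ^ 2 * hss
    have hmin : minpoly ℚ α = q := by
      refine Polynomial.eq_of_dvd_of_natDegree_le_of_leadingCoeff (minpoly.dvd ℚ α hroot) ?_ ?_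
      · rw [hqdeg, minpoly.two_le_natDegree_iff hαint]
        rintro ⟨r, hr⟩
        exact hαirr ⟨r, hr⟩
      · rw [hqm, minpoly.monic hαint]
    have hmap := minpoly.isIntegrallyClosed_eq_field_fractions' ℚ h
    rw [hmin] at hmap
    have h1 := congrArg (fun p => Polynomial.coeff p 1) hmap
    have h0 := congrArg (fun p => Polynomial.coeff p 0) hmap
    simp only [q, Polynomial.coeff_add, Polynomial.coeff_sub, Polynomial.coeff_X_pow,
      Polynomial.coeff_C_mul, Polynomial.coeff_X, Polynomial.coeff_C, Polynomial.coeff_map,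
      eq_intCast] at h1 h0
    norm_num at h1 h0
    refine exists_int_coords_of_int_trace_norm hD hsq (m := -(minpoly ℤ α).coeff 1)
      (n := (minpoly ℤ α).coeff 0) ?_ ?_
    · push_cast
      linarith
    · linarith

theorem Zsqrtd.toReal_natCast_apply {D : ℕ} (w : ℤ√(D : ℤ)) :
    Zsqrtd.toReal (Int.natCast_nonneg D) w = w.re + w.im * Real.sqrt D := by
  simp [Zsqrtd.toReal]

theorem isUnit_zsqrtd_iff {D : ℕ} {w : ℤ√(D : ℤ)} :
    IsUnit w ↔ w.re ^ 2 - D * w.im ^ 2 = 1 ∨ w.re ^ 2 - D * w.im ^ 2 = -1 := by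
  rw [← Zsqrtd.norm_eq_one_iff, Int.natAbs_eq_iff, Zsqrtd.norm_def]
  ring_nf

/-- Every unit of `ℤ[√D]`, with `D ≡ 2 (mod 4)`, is up to sign a power of the fundamental unit. -/
theorem IsFundUnit.exists_zpow {D : ℕ} (hD : D % 4 = 2) {ε : ℝ} (hε : IsFundUnit D ε)
    (v : (ℤ√(D : ℤ))ˣ) : ∃ k : ℤ,
      Zsqrtd.toReal (Int.natCast_nonneg D) v = ε ^ k ∨
        Zsqrtd.toReal (Int.natCast_nonneg D) v = -ε ^ k := by
  obtain ⟨hε1, ⟨x, y, hxy, hnorm⟩, hmin⟩ := hε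
  have hε0 : 0 < ε := one_pos.trans hε1
  let φ := Zsqrtd.toReal (Int.natCast_nonneg D)
  obtain ⟨e, he⟩ : ∃ e : (ℤ√(D : ℤ))ˣ, φ e = ε := by
    obtain ⟨X, Y, rfl, rfl⟩ := exists_two_mul_of_sq_sub_mul_sq hD
      (show 4 ∣ x ^ 2 - (D : ℤ) * y ^ 2 by omega)
    have hu : IsUnit (⟨X, Y⟩ : ℤ√(D : ℤ)) := by
      rw [isUnit_zsqrtd_iff]
      rcases hnorm with h | h
      · exact Or.inl (by linarith)
      · exact Or.inr (by linarith)
    refine ⟨hu.unit, ?_⟩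
    rw [IsUnit.unit_spec, Zsqrtd.toReal_natCast_apply, hxy]
    push_cast
    ring
  have hv0 : 0 < |φ v| := abs_pos.2 (v.isUnit.map φ).ne_zero
  obtain ⟨k, hk1, hk2⟩ := exists_mem_Ico_zpow hv0 hε1
  have hεk : 0 < ε ^ k := zpow_pos hε0 k
  have hek : ∀ k : ℤ, φ ((e ^ k : (ℤ√(D : ℤ))ˣ) : ℤ√(D : ℤ)) = ε ^ k := fun k => by
    have := congrArg Units.val (map_zpow (Units.map (φ : ℤ√(D : ℤ) →* ℝ)) e k)
    rw [← he]
    simpa only [Units.coe_map, Units.val_zpow_eq_zpow_val, MonoidHom.coe_coe] using this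
  obtain ⟨w, hw⟩ : ∃ w : (ℤ√(D : ℤ))ˣ, φ w = |φ v| / ε ^ k := by
    rcases abs_choice (φ v) with h | h
    · exact ⟨v * e ^ (-k), by rw [Units.val_mul, map_mul, hek, h, zpow_neg, div_eq_mul_inv]⟩
    · exact ⟨-v * e ^ (-k), by
        rw [Units.val_mul, map_mul, hek, h, zpow_neg, div_eq_mul_inv, Units.val_neg, map_neg]⟩
  have hw1 : ¬ 1 < |φ v| / ε ^ k := fun hlt => by
    have hwe : |φ v| / ε ^ k = (((2 * (w : ℤ√(D : ℤ)).re : ℤ) : ℝ) +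
        ((2 * (w : ℤ√(D : ℤ)).im : ℤ) : ℝ) * Real.sqrt D) / 2 := by
      rw [← hw, Zsqrtd.toReal_natCast_apply]
      push_cast
      ring
    have hle := hmin (2 * (w : ℤ√(D : ℤ)).re) (2 * (w : ℤ√(D : ℤ)).im) (by
      rcases isUnit_zsqrtd_iff.1 w.isUnit with h | h
      · exact Or.inl (by linarith)
      · exact Or.inr (by linarith)) (by rwa [← hwe])
    rw [← hwe, le_div_iff₀ hεk] at hle
    rw [zpow_add_one₀ hε0.ne'] at hk2
    linarith
  have habs : |φ v| = ε ^ k := le_antisymm (by rwa [one_lt_div hεk, not_lt] at hw1) hk1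
  exact ⟨k, (abs_eq hεk.le).1 habs⟩

/-- The elements of `ℚ(√D, i) ⊆ ℂ` written in the basis `1, √D, i, i√D`. -/
theorem exists_rat_coords_of_mem_adjoin {D : ℕ} {z : ℂ}
    (hz : z ∈ ℚ⟮((Real.sqrt D : ℝ) : ℂ), Complex.I⟯) : ∃ a b c e : ℚ,
      z = ((a + b * Real.sqrt D : ℝ) : ℂ) + ((c + e * Real.sqrt D : ℝ) : ℂ) * Complex.I := by
  have hss : ((Real.sqrt D : ℝ) : ℂ) ^ 2 = D := by
    exact_mod_cast congrArg Complex.ofReal (Real.sq_sqrt (Nat.cast_nonneg D))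
  have hI := Complex.I_sq
  have halg : ∀ x ∈ ({((Real.sqrt D : ℝ) : ℂ), Complex.I} : Set ℂ), IsAlgebraic ℚ x := by
    rintro x (rfl | rfl)
    · refine (IsIntegral.of_pow (n := 2) two_pos ?_).isAlgebraic
      rw [hss]
      simpa using isIntegral_algebraMap (R := ℚ) (A := ℂ) (x := (D : ℚ))
    · refine (IsIntegral.of_pow (n := 2) two_pos ?_).isAlgebraic
      rw [hI]
      exact isIntegral_one.neg
  rw [← IntermediateField.mem_toSubalgebra,
    IntermediateField.adjoin_toSubalgebra_of_isAlgebraic halg] at hz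
  induction hz using Algebra.adjoin_induction with
  | mem x hx =>
    rcases hx with rfl | rfl
    · exact ⟨0, 1, 0, 0, by simp⟩
    · exact ⟨0, 0, 1, 0, by simp⟩
  | algebraMap r => exact ⟨r, 0, 0, 0, by simp⟩
  | add x y _ _ hx hy =>
    obtain ⟨a, b, c, e, rfl⟩ := hx
    obtain ⟨a', b', c', e', rfl⟩ := hy
    refine ⟨a + a', b + b', c + c', e + e', ?_⟩
    push_cast
    ring
  | mul x y _ _ hx hy =>
    obtain ⟨a, b, c, e, rfl⟩ := hx
    obtain ⟨a', b', c', e', rfl⟩ := hy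
    refine ⟨a * a' + D * b * b' - c * c' - D * e * e', a * b' + b * a' - c * e' - e * c',
      a * c' + D * b * e' + c * a' + D * e * b', a * e' + b * c' + c * b' + e * a', ?_⟩
    push_cast
    generalize ((Real.sqrt D : ℝ) : ℂ) = s at *
    generalize Complex.I = i at *
    linear_combination (b * b' + (b * e' + e * b') * i - e * e') * hss +
      (c + e * s) * (c' + e' * s) * hI

/-- Real algebraic integers of `ℚ(√D, i)` lie in `ℤ[√D]`. -/
theorem exists_zsqrtd_of_real_of_isIntegral {D : ℕ} (hD : D % 4 = 2) (hsq : Squarefree D) {r : ℝ}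
    (hr : (r : ℂ) ∈ ℚ⟮((Real.sqrt D : ℝ) : ℂ), Complex.I⟯) (hint : IsIntegral ℤ (r : ℂ)) :
    ∃ w : ℤ√(D : ℤ), Zsqrtd.toReal (Int.natCast_nonneg D) w = r := by
  obtain ⟨a, b, c, e, h⟩ := exists_rat_coords_of_mem_adjoin hr
  have hre : r = a + b * Real.sqrt D := by
    simpa using congrArg Complex.re h
  have hint' : IsIntegral ℤ r :=
    (isIntegral_algHom_iff (Complex.ofRealAm.restrictScalars ℤ) Complex.ofReal_injective).1 hint
  rw [hre] at hint'
  obtain ⟨x, y, rfl, rfl⟩ := exists_int_coords_of_isIntegral hD hsq hint'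
  exact ⟨⟨x, y⟩, by rw [Zsqrtd.toReal_natCast_apply, hre]; simp⟩

theorem toReal_natCast_injective {D : ℕ} (hD : D % 4 = 2) :
    Function.Injective (Zsqrtd.toReal (Int.natCast_nonneg D)) := by
  refine Zsqrtd.toReal_injective _ fun n hn => ?_
  obtain ⟨y, z, -, h⟩ := exists_two_mul_of_sq_sub_mul_sq hD (m := n) (c := 1) (by simp [hn, sq])
  omega

/-- A real unit of the ring of integers of `ℚ(√D, i)` is a unit of `ℤ[√D]`. -/
theorem exists_zsqrtd_unit_of_real {D : ℕ} (hD : D % 4 = 2) (hsq : Squarefree D) {r : ℝ}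
    (hr0 : r ≠ 0) (hr : (r : ℂ) ∈ ℚ⟮((Real.sqrt D : ℝ) : ℂ), Complex.I⟯)
    (hint : IsIntegral ℤ (r : ℂ)) (hint' : IsIntegral ℤ (r : ℂ)⁻¹) :
    ∃ w : (ℤ√(D : ℤ))ˣ, Zsqrtd.toReal (Int.natCast_nonneg D) w = r := by
  obtain ⟨w, hw⟩ := exists_zsqrtd_of_real_of_isIntegral hD hsq hr hint
  obtain ⟨w', hw'⟩ := exists_zsqrtd_of_real_of_isIntegral hD hsq (r := r⁻¹)
    (by rw [Complex.ofReal_inv]; exact inv_mem hr) (by rwa [Complex.ofReal_inv])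
  have hww : w * w' = 1 := toReal_natCast_injective hD (by
    rw [map_mul, hw, hw', map_one, mul_inv_cancel₀ hr0])
  exact ⟨⟨w, w', hww, by rw [mul_comm, hww]⟩, hw⟩

theorem conj_mem_adjoin_sqrt_I {D : ℕ} {z : ℂ}
    (hz : z ∈ ℚ⟮((Real.sqrt D : ℝ) : ℂ), Complex.I⟯) :
    (starRingEnd ℂ) z ∈ ℚ⟮((Real.sqrt D : ℝ) : ℂ), Complex.I⟯ := by
  obtain ⟨a, b, c, e, rfl⟩ := exists_rat_coords_of_mem_adjoin hz
  have hs : ((Real.sqrt D : ℝ) : ℂ) ∈ ℚ⟮((Real.sqrt D : ℝ) : ℂ), Complex.I⟯ :=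
    subset_adjoin _ _ (by simp)
  have hI : Complex.I ∈ ℚ⟮((Real.sqrt D : ℝ) : ℂ), Complex.I⟯ := subset_adjoin _ _ (by simp)
  have hq (q : ℚ) : (q : ℂ) ∈ ℚ⟮((Real.sqrt D : ℝ) : ℂ), Complex.I⟯ :=
    IntermediateField.algebraMap_mem _ q
  rw [map_add, map_mul, Complex.conj_I, Complex.conj_ofReal, Complex.conj_ofReal]
  push_cast
  exact add_mem (add_mem (hq a) (mul_mem (hq b) hs))
    (mul_mem (add_mem (hq c) (mul_mem (hq e) hs)) (neg_mem hI))

theorem IsIntegral.conj {z : ℂ} (hz : IsIntegral ℤ z) : IsIntegral ℤ ((starRingEnd ℂ) z) :=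
  hz.map (starRingEnd ℂ).toIntAlgHom

theorem Complex.isIntegral_I : IsIntegral ℤ Complex.I :=
  IsIntegral.of_pow (n := 2) two_pos (by rw [Complex.I_sq]; exact isIntegral_one.neg)

/-- An algebraic integer of absolute value one in `ℚ(√D, i)` is a fourth root of unity. -/
theorem eq_of_isIntegral_of_norm_eq_one {D : ℕ} (hD : D % 4 = 2) (hsq : Squarefree D)
    (hD4 : 4 < D) {ω : ℂ} (hω : ω ∈ ℚ⟮((Real.sqrt D : ℝ) : ℂ), Complex.I⟯)
    (hint : IsIntegral ℤ ω) (hnorm : ω * (starRingEnd ℂ) ω = 1) :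
    ω = 1 ∨ ω = -1 ∨ ω = Complex.I ∨ ω = -Complex.I := by
  have hI : Complex.I ∈ ℚ⟮((Real.sqrt D : ℝ) : ℂ), Complex.I⟯ := subset_adjoin _ _ (by simp)
  have hre : ((2 * ω.re : ℝ) : ℂ) = ω + (starRingEnd ℂ) ω := by
    rw [Complex.add_conj]
  have him : ((2 * ω.im : ℝ) : ℂ) = (ω - (starRingEnd ℂ) ω) * (-Complex.I) := by
    rw [Complex.sub_conj]
    linear_combination ((2 * ω.im : ℝ) : ℂ) * Complex.I_sq
  obtain ⟨⟨x, y⟩, hA⟩ := exists_zsqrtd_of_real_of_isIntegral hD hsq (r := 2 * ω.re)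
    (by rw [hre]; exact add_mem hω (conj_mem_adjoin_sqrt_I hω))
    (by rw [hre]; exact hint.add hint.conj)
  obtain ⟨⟨z, w⟩, hB⟩ := exists_zsqrtd_of_real_of_isIntegral hD hsq (r := 2 * ω.im)
    (by rw [him]; exact mul_mem (sub_mem hω (conj_mem_adjoin_sqrt_I hω)) (neg_mem hI))
    (by rw [him]; exact (hint.sub hint.conj).mul Complex.isIntegral_I.neg)
  have hAB : (2 * ω.re) ^ 2 + (2 * ω.im) ^ 2 = 4 := by
    rw [Complex.mul_conj, Complex.normSq_apply] at hnorm
    have : ω.re * ω.re + ω.im * ω.im = 1 := by exact_mod_cast hnorm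
    linear_combination 4 * this
  have hZ : (⟨x, y⟩ : ℤ√(D : ℤ)) ^ 2 + ⟨z, w⟩ ^ 2 = 4 := toReal_natCast_injective hD (by
    rw [map_add, map_pow, map_pow, hA, hB, hAB]
    simp)
  have hsum : x ^ 2 + D * y ^ 2 + (z ^ 2 + D * w ^ 2) = 4 := by
    have := congrArg Zsqrtd.re hZ
    simp only [sq, Zsqrtd.re_add, Zsqrtd.re_mul, Zsqrtd.re_ofNat] at this
    push_cast at this
    linarith
  have hD4' : (4 : ℤ) < D := by exact_mod_cast hD4
  have hy : y = 0 := by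
    by_contra hy
    have := sq_pos_of_ne_zero hy
    nlinarith [sq_nonneg x, sq_nonneg z, sq_nonneg w]
  have hw : w = 0 := by
    by_contra hw
    have := sq_pos_of_ne_zero hw
    nlinarith [sq_nonneg x, sq_nonneg z, sq_nonneg y]
  subst hy hw
  rw [Zsqrtd.toReal_natCast_apply] at hA hB
  simp only [Int.cast_zero, zero_mul, add_zero] at hA hB
  have hx1 : x ≤ 2 := by nlinarith [sq_nonneg z]
  have hx2 : -2 ≤ x := by nlinarith [sq_nonneg z]
  have hz1 : z ≤ 2 := by nlinarith [sq_nonneg x]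
  have hz2 : -2 ≤ z := by nlinarith [sq_nonneg x]
  simp only [Complex.ext_iff, Complex.one_re, Complex.one_im, Complex.neg_re, Complex.neg_im,
    Complex.I_re, Complex.I_im]
  interval_cases x <;> interval_cases z <;> norm_num at hsum <;> norm_num at hA hB
  · exact Or.inr (Or.inl ⟨by linarith, by linarith⟩)
  · exact Or.inr (Or.inr (Or.inr ⟨by linarith, by linarith⟩))
  · exact Or.inr (Or.inr (Or.inl ⟨by linarith, by linarith⟩))
  · exact Or.inl ⟨by linarith, by linarith⟩

/-- If `x² - Dy² = ±2` has no integral solution, no unit `u` of `ℚ(√D, i)` satisfies `u = i ū`. -/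
theorem ne_I_mul_conj_of_isIntegral {D : ℕ} (hD : D % 4 = 2) (hsq : Squarefree D)
    (hno : ∀ x y : ℤ, x ^ 2 - D * y ^ 2 ≠ 2 ∧ x ^ 2 - D * y ^ 2 ≠ -2) {u : ℂ} (hu0 : u ≠ 0)
    (hu : u ∈ ℚ⟮((Real.sqrt D : ℝ) : ℂ), Complex.I⟯)
    (hint : IsIntegral ℤ u) (hint' : IsIntegral ℤ u⁻¹) :
    u ≠ Complex.I * (starRingEnd ℂ) u := by
  intro h
  have hI : Complex.I ∈ ℚ⟮((Real.sqrt D : ℝ) : ℂ), Complex.I⟯ := subset_adjoin _ _ (by simp)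
  have hI2 := Complex.I_sq
  have ht : (starRingEnd ℂ) ((1 - Complex.I) * u) = (1 - Complex.I) * u := by
    rw [map_mul, map_sub, map_one, Complex.conj_I]
    linear_combination (Complex.I - 1) * h + (starRingEnd ℂ u) * hI2
  obtain ⟨t, htu⟩ := Complex.conj_eq_iff_real.1 ht
  obtain ⟨⟨x, y⟩, hxy⟩ := exists_zsqrtd_of_real_of_isIntegral hD hsq (r := t)
    (by rw [← htu]; exact mul_mem (sub_mem (one_mem _) hI) hu)
    (by rw [← htu]; exact (isIntegral_one.sub Complex.isIntegral_I).mul hint)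
  have hn0 : Complex.normSq u ≠ 0 := by simpa using hu0
  have hn : ((Complex.normSq u : ℝ) : ℂ) = u * (starRingEnd ℂ) u := (Complex.mul_conj u).symm
  obtain ⟨v, hv⟩ := exists_zsqrtd_unit_of_real hD hsq hn0
    (by rw [hn]; exact mul_mem hu (conj_mem_adjoin_sqrt_I hu))
    (by rw [hn]; exact hint.mul hint.conj)
    (by rw [hn, mul_inv, ← map_inv₀]; exact hint'.mul hint'.conj)
  have ht2 : t ^ 2 = 2 * Complex.normSq u := by
    have : (t : ℂ) ^ 2 = 2 * ((Complex.normSq u : ℝ) : ℂ) := by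
      rw [hn, ← htu]
      linear_combination (-2 * Complex.I * u) * h + (u ^ 2 - 2 * u * starRingEnd ℂ u) * hI2
    exact_mod_cast this
  have hZ : (⟨x, y⟩ : ℤ√(D : ℤ)) ^ 2 = 2 * v := toReal_natCast_injective hD (by
    rw [map_pow, map_mul, hxy, hv, ht2]
    simp)
  have hN := congrArg Zsqrtd.norm hZ
  have hvn := Zsqrtd.norm_eq_one_iff.2 v.isUnit
  have hxyn : (⟨x, y⟩ : ℤ√(D : ℤ)).norm = x ^ 2 - D * y ^ 2 := by
    rw [Zsqrtd.norm_def]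
    ring
  have h2 : (2 : ℤ√(D : ℤ)).norm = 4 := by
    simp [Zsqrtd.norm_def]
  rw [Zsqrtd.norm_mul, sq, Zsqrtd.norm_mul, hxyn, h2] at hN
  obtain ⟨hne, hne'⟩ := hno x y
  rcases Int.natAbs_eq_iff.1 hvn with hv1 | hv1
  · rw [hv1] at hN
    have : (x ^ 2 - D * y ^ 2 - 2) * (x ^ 2 - D * y ^ 2 + 2) = 0 := by
      push_cast at hN
      linarith
    rcases mul_eq_zero.1 this with h | h
    · exact hne (by linarith)
    · exact hne' (by linarith)
  · rw [hv1] at hN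
    push_cast at hN
    nlinarith [sq_nonneg (x ^ 2 - (D : ℤ) * y ^ 2)]

/-- If `D ≡ 2 (mod 4)` is squarefree, `D > 4` and `x² - Dy² = ±2` has no integral solution, then
the units of `ℚ(√D, i)` are generated by `i` and the fundamental unit of `ℚ(√D)`. -/
theorem IsFundUnit.exists_I_zpow_mul_zpow {D : ℕ} (hD : D % 4 = 2) (hsq : Squarefree D)
    (hD4 : 4 < D) (hno : ∀ x y : ℤ, x ^ 2 - D * y ^ 2 ≠ 2 ∧ x ^ 2 - D * y ^ 2 ≠ -2)
    {ε : ℝ} (hε : IsFundUnit D ε) {u : ℂ} (hu0 : u ≠ 0)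
    (hu : u ∈ ℚ⟮((Real.sqrt D : ℝ) : ℂ), Complex.I⟯)
    (hint : IsIntegral ℤ u) (hint' : IsIntegral ℤ u⁻¹) :
    ∃ j k : ℤ, u = Complex.I ^ j * (ε : ℂ) ^ k := by
  have hI : Complex.I ∈ ℚ⟮((Real.sqrt D : ℝ) : ℂ), Complex.I⟯ := subset_adjoin _ _ (by simp)
  have hc0 : (starRingEnd ℂ) u ≠ 0 := by simpa using hu0
  have hreal : ∀ r : ℝ, (r : ℂ) ≠ 0 → (r : ℂ) ∈ ℚ⟮((Real.sqrt D : ℝ) : ℂ), Complex.I⟯ →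
      IsIntegral ℤ (r : ℂ) → IsIntegral ℤ (r : ℂ)⁻¹ →
      ∃ j k : ℤ, (r : ℂ) = Complex.I ^ j * (ε : ℂ) ^ k := by
    intro r hr0 hr h h'
    obtain ⟨w, hw⟩ := exists_zsqrtd_unit_of_real hD hsq (by exact_mod_cast hr0) hr h h'
    obtain ⟨k, hk | hk⟩ := hε.exists_zpow hD w
    · exact ⟨0, k, by rw [← hw, hk]; simp⟩
    · refine ⟨2, k, ?_⟩
      rw [← hw, hk, zpow_ofNat, Complex.I_sq]
      simp
  rcases eq_of_isIntegral_of_norm_eq_one hD hsq hD4 (ω := u * ((starRingEnd ℂ) u)⁻¹)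
    (mul_mem hu (inv_mem (conj_mem_adjoin_sqrt_I hu)))
    (hint.mul (by rw [← map_inv₀]; exact hint'.conj))
    (by simp; field_simp) with h | h | h | h <;> rw [mul_inv_eq_iff_eq_mul₀ hc0] at h
  · obtain ⟨r, rfl⟩ := Complex.conj_eq_iff_real.1 (h.trans (one_mul _)).symm
    exact hreal r hu0 hu hint hint'
  · have hc : (starRingEnd ℂ) (Complex.I * u) = Complex.I * u := by
      rw [map_mul, Complex.conj_I]
      linear_combination -Complex.I * h
    obtain ⟨r, hr⟩ := Complex.conj_eq_iff_real.1 hc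
    obtain ⟨j, k, hjk⟩ := hreal r (by rw [← hr]; exact mul_ne_zero Complex.I_ne_zero hu0)
      (by rw [← hr]; exact mul_mem hI hu)
      (by rw [← hr]; exact Complex.isIntegral_I.mul hint)
      (by rw [← hr, mul_inv, Complex.inv_I]; exact Complex.isIntegral_I.neg.mul hint')
    refine ⟨j - 1, k, ?_⟩
    rw [zpow_sub_one₀ Complex.I_ne_zero, mul_right_comm, ← hjk, ← hr]
    field_simp
  · exact (ne_I_mul_conj_of_isIntegral hD hsq hno hu0 hu hint hint' h).elim
  · refine (ne_I_mul_conj_of_isIntegral hD hsq hno hc0 (conj_mem_adjoin_sqrt_I hu) hint.conj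
      (by rw [← map_inv₀]; exact hint'.conj) ?_).elim
    rw [Complex.conj_conj]
    linear_combination -Complex.I * h + (starRingEnd ℂ u) * Complex.I_sq

/-- For a prime `p ≡ 5 (mod 8)` dividing `D`, the numbers `±2` are not norms from `ℤ[√D]`. -/
theorem sq_sub_mul_sq_ne_two {p D : ℕ} (hp : p.Prime) (hp8 : p % 8 = 5) (hpD : p ∣ D) (x y : ℤ) :
    x ^ 2 - D * y ^ 2 ≠ 2 ∧ x ^ 2 - D * y ^ 2 ≠ -2 := by
  have := Fact.mk hp
  have hD : (D : ZMod p) = 0 := (ZMod.natCast_eq_zero_iff D p).2 hpD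
  constructor <;> intro h <;> have h' := congrArg (Int.cast : ℤ → ZMod p) h <;>
    push_cast at h' <;> rw [hD, zero_mul, sub_zero] at h'
  · have := (ZMod.exists_sq_eq_two_iff (p := p) (by omega)).1 ⟨x, by rw [← h', sq]⟩
    omega
  · have := (ZMod.exists_sq_eq_neg_two_iff (p := p) (by omega)).1 ⟨x, by rw [← h', sq]⟩
    omega

/-- Every unit of the ring of integers of `𝕜 = ℚ(√(2p₁p₂), i)` is of the
form `i^j · ε_{2p₁p₂}^k` with `j, k ∈ ℤ`, where `ε_{2p₁p₂}` is the fundamental unit of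
`ℚ(√(2p₁p₂))`. -/
theorem stmt_9 (p₁ p₂ : ℕ) (hp₁ : p₁.Prime) (hp₂ : p₂.Prime) (hne : p₁ ≠ p₂)
    (hm₁ : p₁ % 8 = 5) (hm₂ : p₂ % 8 = 5)
    (𝕜 : IntermediateField ℚ ℂ)
    (h𝕜 : 𝕜 = ℚ⟮((Real.sqrt (2 * (p₁ : ℝ) * p₂) : ℝ) : ℂ), Complex.I⟯)
    [NumberField 𝕜]
    (ε : ℝ) (hε : IsFundUnit (2 * p₁ * p₂) ε) :
    ∀ u : (RingOfIntegers 𝕜)ˣ, ∃ j k : ℤ,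
      ((algebraMap (RingOfIntegers 𝕜) 𝕜 (u : RingOfIntegers 𝕜) : 𝕜) : ℂ)
        = Complex.I ^ j * ((ε : ℝ) : ℂ) ^ k := by
  have hD : 2 * p₁ * p₂ % 4 = 2 := by
    have h : p₁ * p₂ % 2 = 1 := by
      rw [Nat.mul_mod, show p₁ % 2 = 1 by omega, show p₂ % 2 = 1 by omega]
    rw [mul_assoc]
    omega
  have hodd : ∀ p : ℕ, p % 8 = 5 → Nat.Coprime 2 p := fun p hp =>
    Nat.coprime_two_left.2 (Nat.odd_iff.2 (by omega))
  have hsq : Squarefree (2 * p₁ * p₂) := by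
    rw [Nat.squarefree_mul ((hodd p₂ hm₂).mul_left ((Nat.coprime_primes hp₁ hp₂).2 hne)),
      Nat.squarefree_mul (hodd p₁ hm₁)]
    exact ⟨⟨Nat.prime_two.squarefree, hp₁.squarefree⟩, hp₂.squarefree⟩
  have hD4 : 4 < 2 * p₁ * p₂ := by
    have : 5 ≤ p₁ := by omega
    have : 5 ≤ p₂ := by omega
    nlinarith
  have hcast : (2 * (p₁ : ℝ) * p₂) = ((2 * p₁ * p₂ : ℕ) : ℝ) := by
    push_cast
    rfl
  rw [hcast] at h𝕜
  intro u
  have hint (v : RingOfIntegers 𝕜) :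
      IsIntegral ℤ ((algebraMap (RingOfIntegers 𝕜) 𝕜 v : 𝕜) : ℂ) :=
    (RingOfIntegers.isIntegral_coe v).map (algebraMap 𝕜 ℂ).toIntAlgHom
  have hinv : ((algebraMap (RingOfIntegers 𝕜) 𝕜 (u : RingOfIntegers 𝕜) : 𝕜) : ℂ) *
      ((algebraMap (RingOfIntegers 𝕜) 𝕜 ((u⁻¹ : (RingOfIntegers 𝕜)ˣ) : RingOfIntegers 𝕜) : 𝕜) : ℂ)
        = 1 := by
    exact_mod_cast congrArg ((↑) : 𝕜 → ℂ) (show algebraMap (RingOfIntegers 𝕜) 𝕜 u *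
      algebraMap (RingOfIntegers 𝕜) 𝕜 (u⁻¹ : (RingOfIntegers 𝕜)ˣ) = 1 by
        rw [← map_mul, Units.mul_inv, map_one])
  refine hε.exists_I_zpow_mul_zpow hD hsq hD4
    (sq_sub_mul_sq_ne_two hp₁ hm₁ ⟨2 * p₂, by ring⟩) (left_ne_zero_of_mul_eq_one hinv) ?_
    (hint u) ?_
  · rw [← h𝕜]
    exact SetLike.coe_mem _
  · rw [inv_eq_of_mul_eq_one_right hinv]
    exact hint _
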